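/- arXiv:1404.4971 — 8 statements merged into one kernel-verified Lean document; each statement's English description precedes it below -/
import Mathlib

section
/- For every integer k ≥ 1 and every ε > 0 there exist real numbers α_0, …, α_{k−1} with 0 < |α_i| < ε for i = 0, …, k−1, such that the polynomial x^{k+1} + α_{k−1} x^{k−1} + … + α_1 x + α_0 has exactly k+1 distinct real roots x_1, …, x_{k+1}, and every root satisfies 0 < |x_i| < k·√ε. -/
open Polynomial Filter Topology in
/-- The distinct roots of `∏ i, (X - x i)` persist, inside prescribed neighbourhoods, when a small
constant is subtracted. -/
theorem eventually_prod_sub_const_eq_prod {n : ℕ} (hn : 0 < n) (x : Fin n → ℝ)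
    (hx : Function.Injective x) (s : Set ℝ) (hs : ∀ i, s ∈ 𝓝 (x i)) :
    ∀ᶠ δ in 𝓝 (0 : ℝ), ∃ z : Fin n → ℝ, Function.Injective z ∧ (∀ i, z i ∈ s) ∧
      ∀ y, (∏ i, (y - x i)) - δ = ∏ i, (y - z i) := by
  set f : ℝ[X] := ∏ i, (X - C (x i)) with hf
  have hfm : f.Monic := monic_prod_of_monic _ _ fun i _ => monic_X_sub_C _
  have hfd : f.degree = n := by simp [hf, degree_prod]
  have hroot : ∀ i, f.eval (x i) = 0 := fun i => by
    rw [hf, eval_prod]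
    exact Finset.prod_eq_zero (Finset.mem_univ i) (by simp)
  have hsep : f.Separable := separable_prod_X_sub_C_iff.2 hx
  obtain ⟨U, hU, hdisj⟩ := (Set.finite_range x).t2_separation
  have hnear : ∀ᶠ δ in 𝓝 (0 : ℝ), ∀ i, ∃ z ∈ U (x i) ∩ s, f.eval z = δ := by
    refine eventually_all.2 fun i => ?_
    have hd : f.derivative.eval (x i) ≠ 0 := by
      simpa using hsep.aeval_derivative_ne_zero (x := x i) (by simpa using hroot i)
    have hmap := (f.hasStrictDerivAt (x i)).map_nhds_eq hd
    rw [hroot i] at hmap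
    rw [← hmap]
    exact image_mem_map (inter_mem ((hU (x i)).2.mem_nhds (hU (x i)).1) (hs i))
  filter_upwards [hnear] with δ hδ
  choose z hz hzδ using hδ
  have hzi : Function.Injective z := fun i j hij => by
    by_contra hne
    exact Set.disjoint_left.1
      (hdisj (Set.mem_range_self i) (Set.mem_range_self j) (hx.ne hne)) (hz i).1
      (hij ▸ (hz j).1)
  refine ⟨z, hzi, fun i => (hz i).2, fun y => ?_⟩
  set g : ℝ[X] := ∏ i, (X - C (z i)) with hg
  have hgm : g.Monic := monic_prod_of_monic _ _ fun i _ => monic_X_sub_C _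
  have hgd : g.degree = n := by simp [hg, degree_prod]
  have hCd : (C δ).degree < f.degree :=
    degree_C_le.trans_lt (by rw [hfd]; exact_mod_cast hn)
  have hfg : f - C δ = g := by
    refine eq_of_degree_sub_lt_of_eval_index_eq (s := Finset.univ) (v := z) hzi.injOn ?_ ?_
    · have hlt := degree_sub_lt_left (p := f - C δ) (q := g)
        (by rw [degree_sub_eq_left_of_degree_lt hCd, hfd, hgd])
        (hfm.sub_of_left hCd).ne_zero
        (by rw [(hfm.sub_of_left hCd).leadingCoeff, hgm.leadingCoeff])
      rwa [degree_sub_eq_left_of_degree_lt hCd, hfd, ← Finset.card_fin n] at hlt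
    · intro i _
      rw [eval_sub, hzδ, eval_C, sub_self, hg, eval_prod]
      exact (Finset.prod_eq_zero (Finset.mem_univ i) (by simp)).symm
  simpa [hf, hg, eval_prod] using congrArg (eval y) hfg

open Filter Topology in
/-- There are polynomials of every degree at least two without subleading term, with all other
coefficients nonzero and arbitrarily small, that split into distinct linear factors with nonzero
and arbitrarily small roots. -/
theorem exists_small_coeffs_eq_prod_sub {k : ℕ} (hk : 1 ≤ k) (η : ℝ) (hη : 0 < η) :
    ∃ α : Fin k → ℝ, (∀ i, 0 < |α i| ∧ |α i| < η) ∧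
      ∃ x : Fin (k + 1) → ℝ, Function.Injective x ∧ (∀ i, 0 < |x i| ∧ |x i| < η) ∧
        ∀ y : ℝ, y ^ (k + 1) + ∑ j : Fin k, α j * y ^ (j : ℕ) = ∏ i, (y - x i) := by
  induction k, hk using Nat.le_induction with
  | base =>
    obtain ⟨c, hc, hcη⟩ := exists_between (lt_min hη one_pos)
    obtain ⟨hcη, hc1⟩ := lt_min_iff.1 hcη
    refine ⟨fun _ => -c ^ 2, fun _ => ?_, ![c, -c], ?_, ?_, fun y => ?_⟩
    · rw [abs_neg, abs_of_pos (by positivity)]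
      exact ⟨by positivity, by nlinarith⟩
    · intro i j
      fin_cases i <;> fin_cases j <;> simp <;> intro h <;> linarith
    · intro i
      fin_cases i <;> simp [abs_of_pos hc, hc, hcη]
    · simp [Fin.prod_univ_two]
      ring
  | succ k hk ih =>
    obtain ⟨α, hα, x, hx, hx0, hprod⟩ := ih
    have hx' : Function.Injective (Fin.cons 0 x : Fin (k + 2) → ℝ) :=
      Fin.cons_injective_iff.2 ⟨fun ⟨i, hi⟩ => abs_pos.1 (hx0 i).1 hi, hx⟩
    have hnhds : ∀ i, Metric.ball (0 : ℝ) η ∈ 𝓝 ((Fin.cons 0 x : Fin (k + 2) → ℝ) i) := by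
      refine fun i => Metric.isOpen_ball.mem_nhds ?_
      cases i using Fin.cases with
      | zero => simpa using hη
      | succ i => simpa using (hx0 i).2
    obtain ⟨r, hr, hball⟩ := Metric.eventually_nhds_iff.1
      (eventually_prod_sub_const_eq_prod (Nat.succ_pos _) _ hx' _ hnhds)
    obtain ⟨δ, hδ, hδlt⟩ := exists_between (lt_min hr hη)
    obtain ⟨hδr, hδη⟩ := lt_min_iff.1 hδlt
    obtain ⟨z, hz, hzη, hzprod⟩ := hball (y := δ) (by simpa [abs_of_pos hδ] using hδr)
    refine ⟨Fin.cons (-δ) α, fun i => ?_, z, hz, fun i => ⟨?_, by simpa using hzη i⟩, fun y => ?_⟩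
    · cases i using Fin.cases with
      | zero => simpa [abs_of_pos hδ] using ⟨hδ, hδη⟩
      | succ i => simpa using hα i
    · rw [abs_pos]
      intro h0
      have h := hzprod 0
      rw [Finset.prod_eq_zero (Finset.mem_univ 0) (by simp),
        Finset.prod_eq_zero (Finset.mem_univ i) (by simp [h0])] at h
      linarith
    · rw [← hzprod y, Fin.prod_univ_succ, Fin.sum_univ_succ]
      simp only [Fin.cons_zero, Fin.cons_succ, ← hprod y, Fin.val_zero, Fin.val_succ, sub_zero,
        mul_add, Finset.mul_sum]
      rw [Finset.sum_congr rfl fun j _ => show α j * y ^ ((j : ℕ) + 1) = y * (α j * y ^ (j : ℕ)) by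
        ring]
      ring

/-- For every integer `k ≥ 1` and every `ε > 0` there exist real numbers
`α 0, …, α (k-1)` with `0 < |α i| < ε`, such that the polynomial
`x^(k+1) + α_{k-1} x^(k-1) + … + α_1 x + α_0` has exactly `k+1` distinct real roots
`x 1, …, x (k+1)`, and every root satisfies `0 < |x i| < k·√ε`. -/
theorem lemma_distinct_small_roots (k : ℕ) (hk : 1 ≤ k) (ε : ℝ) (hε : 0 < ε) :
    ∃ α : Fin k → ℝ,
      (∀ i : Fin k, 0 < |α i| ∧ |α i| < ε) ∧
      ∃ x : Fin (k + 1) → ℝ,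
        Function.Injective x ∧
        (∀ i : Fin (k + 1),
          (x i) ^ (k + 1) + ∑ j : Fin k, α j * (x i) ^ (j : ℕ) = 0 ∧
          0 < |x i| ∧ |x i| < (k : ℝ) * Real.sqrt ε) ∧
        (∀ y : ℝ, y ^ (k + 1) + ∑ j : Fin k, α j * y ^ (j : ℕ) = 0 → ∃ i, y = x i) := by
  have hk0 : (0 : ℝ) < k := by exact_mod_cast hk
  obtain ⟨α, hα, x, hx, hx0, hprod⟩ := exists_small_coeffs_eq_prod_sub hk
    (min ε (k * Real.sqrt ε)) (lt_min hε (mul_pos hk0 (Real.sqrt_pos.2 hε)))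
  refine ⟨α, fun i => ⟨(hα i).1, (hα i).2.trans_le (min_le_left _ _)⟩, x, hx,
    fun i => ⟨?_, (hx0 i).1, (hx0 i).2.trans_le (min_le_right _ _)⟩, fun y hy => ?_⟩
  · rw [hprod]
    exact Finset.prod_eq_zero (Finset.mem_univ i) (sub_self _)
  · rw [hprod, Finset.prod_eq_zero_iff] at hy
    obtain ⟨i, _, hi⟩ := hy
    exact ⟨i, sub_eq_zero.1 hi⟩
end

section
/- Let k ≥ 1 be an integer. For every pair of neighbourhoods Û, V̂ of the origin in ℝ^k there exists a point ŝ ∈ V̂ such that the equation w_k(t) = ŝ has exactly k+1 pairwise distinct solutions t̂_1, …, t̂_{k+1}, all of which lie in Û, and each solution t̂_i is a regular point of w_k. -/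
/-- The Whitney map `w_k : ℝ^k → ℝ^k`. -/
noncomputable def whitney (k : ℕ) (hk : 0 < k) (x : Fin k → ℝ) : Fin k → ℝ :=
  fun j => if (j : ℕ) = 0 then
      (x ⟨0, hk⟩) ^ (k + 1) +
        ∑ i : Fin k, (if (i : ℕ) = 0 then 0 else x i * (x ⟨0, hk⟩) ^ (i : ℕ))
    else x j

open Polynomial Filter Topology

/-- The point of `ℝ^k` with first coordinate `y` and `j`-th coordinate the `j`-th coefficient
of `Q` for `0 < j < k`. -/
noncomputable def coeffPoint (k : ℕ) (Q : ℝ[X]) (y : ℝ) : Fin k → ℝ :=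
  fun j => if (j : ℕ) = 0 then y else Q.coeff j

theorem whitney_apply_of_ne {k : ℕ} (hk : 0 < k) (x : Fin k → ℝ) {j : Fin k}
    (hj : (j : ℕ) ≠ 0) : whitney k hk x j = x j := by
  simp [whitney, hj]

/-- On the line of points with coordinates the coefficients of a monic polynomial `Q` of degree
`k + 1` with vanishing `k`-th coefficient, the Whitney map is evaluation of `Q - Q.coeff 0`. -/
theorem whitney_coeffPoint {k : ℕ} (hk : 0 < k) {Q : ℝ[X]} (hQ : Q.Monic)
    (hdeg : Q.natDegree = k + 1) (hcoeff : Q.coeff k = 0) (y : ℝ) :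
    whitney k hk (coeffPoint k Q y) = coeffPoint k Q (Q.eval y - Q.coeff 0) := by
  have hlead : Q.coeff (k + 1) = 1 := hdeg ▸ hQ.coeff_natDegree
  funext j
  by_cases hj : (j : ℕ) = 0
  · have hsum : (∑ i : Fin k, if (i : ℕ) = 0 then 0 else coeffPoint k Q y i * y ^ (i : ℕ)) =
        ∑ i ∈ Finset.range k, if i = 0 then 0 else Q.coeff i * y ^ i := by
      rw [← Fin.sum_univ_eq_sum_range (fun i => if i = 0 then 0 else Q.coeff i * y ^ i)]
      refine Finset.sum_congr rfl fun i _ => ?_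
      by_cases hi : (i : ℕ) = 0 <;> simp [coeffPoint, hi]
    have heval : Q.eval y = ∑ i ∈ Finset.range (k + 2), Q.coeff i * y ^ i :=
      eval_eq_sum_range' (by omega) y
    rw [Finset.sum_range_succ, Finset.sum_range_succ, hcoeff, hlead] at heval
    obtain ⟨m, rfl⟩ : ∃ m, k = m + 1 := ⟨k - 1, by omega⟩
    rw [Finset.sum_range_succ'] at heval hsum
    have h0 : coeffPoint (m + 1) Q y ⟨0, hk⟩ = y := by simp [coeffPoint]
    simp only [whitney, hj, if_true, h0, hsum]
    simp only [coeffPoint, hj, if_true, heval]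
    simp
    ring
  · rw [whitney_apply_of_ne hk _ hj]
    simp [coeffPoint, hj]

theorem eq_coeffPoint_of_whitney_eq {k : ℕ} (hk : 0 < k) {Q : ℝ[X]} {c : ℝ} {u : Fin k → ℝ}
    (hu : whitney k hk u = coeffPoint k Q c) : u = coeffPoint k Q (u ⟨0, hk⟩) := by
  funext j
  by_cases hj : (j : ℕ) = 0
  · obtain rfl : j = ⟨0, hk⟩ := Fin.ext hj
    simp [coeffPoint]
  · rw [← whitney_apply_of_ne hk u hj, hu]
    simp [coeffPoint, hj]

theorem coeffPoint_injective {k : ℕ} (hk : 0 < k) (Q : ℝ[X]) :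
    Function.Injective (coeffPoint k Q) := fun y z h => by
  simpa [coeffPoint] using congrFun h ⟨0, hk⟩

theorem differentiable_whitney {k : ℕ} (hk : 0 < k) : Differentiable ℝ (whitney k hk) := by
  refine differentiable_pi.2 fun j => ?_
  by_cases hj : (j : ℕ) = 0
  · simp only [whitney, hj, if_true]
    refine Differentiable.add (by fun_prop) (Differentiable.fun_sum fun i _ => ?_)
    split_ifs <;> fun_prop
  · simp only [whitney, hj, if_false]
    fun_prop

theorem hasDerivAt_coeffPoint {k : ℕ} (hk : 0 < k) (Q : ℝ[X]) {f : ℝ → ℝ} {f' y : ℝ}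
    (hf : HasDerivAt f f' y) :
    HasDerivAt (fun z => coeffPoint k Q (f z)) (Pi.single ⟨0, hk⟩ f') y := by
  refine hasDerivAt_pi.2 fun j => ?_
  by_cases hj : (j : ℕ) = 0
  · obtain rfl : j = ⟨0, hk⟩ := Fin.ext hj
    simpa [coeffPoint] using hf
  · have hne : j ≠ ⟨0, hk⟩ := fun h => hj (congrArg Fin.val h)
    simpa [coeffPoint, hj, hne] using hasDerivAt_const y (Q.coeff j)

theorem bijective_fderiv_whitney_coeffPoint {k : ℕ} (hk : 0 < k) {Q : ℝ[X]} (hQ : Q.Monic)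
    (hdeg : Q.natDegree = k + 1) (hcoeff : Q.coeff k = 0) {y : ℝ}
    (hy : Q.derivative.eval y ≠ 0) :
    Function.Bijective (fderiv ℝ (whitney k hk) (coeffPoint k Q y)) := by
  set L := fderiv ℝ (whitney k hk) (coeffPoint k Q y)
  have hL : HasFDerivAt (whitney k hk) L (coeffPoint k Q y) :=
    (differentiable_whitney hk _).hasFDerivAt
  have hfirst : L (Pi.single ⟨0, hk⟩ 1) = Pi.single ⟨0, hk⟩ (Q.derivative.eval y) := by
    refine (hL.comp_hasDerivAt y (hasDerivAt_coeffPoint hk Q (hasDerivAt_id y))).unique ?_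
    have h := hasDerivAt_coeffPoint hk Q ((Q.hasDerivAt y).sub_const (Q.coeff 0))
    exact h.congr_of_eventuallyEq
      (.of_forall fun z => whitney_coeffPoint hk hQ hdeg hcoeff z)
  have hrest (v : Fin k → ℝ) {j : Fin k} (hj : (j : ℕ) ≠ 0) : L v j = v j := by
    have h := hasFDerivAt_pi'.1 hL j
    simp only [whitney_apply_of_ne hk _ hj] at h
    exact DFunLike.congr_fun (h.unique (hasFDerivAt_apply j _)) v
  have hinj : Function.Injective L := by
    refine (injective_iff_map_eq_zero L).2 fun v hv => ?_
    have hv0 : v = v ⟨0, hk⟩ • Pi.single ⟨0, hk⟩ 1 := by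
      funext j
      by_cases hj : (j : ℕ) = 0
      · obtain rfl : j = ⟨0, hk⟩ := Fin.ext hj
        simp
      · have hne : j ≠ ⟨0, hk⟩ := fun h => hj (congrArg Fin.val h)
        simp [← hrest v hj, hv, hne]
    rw [hv0, map_smul, hfirst] at hv
    have h := congrFun hv ⟨0, hk⟩
    have h0 : v ⟨0, hk⟩ = 0 := by simpa [hy] using h
    rw [hv0, h0, zero_smul]
  exact ⟨hinj, (LinearMap.injective_iff_surjective (f := L.toLinearMap)).1 hinj⟩

theorem prod_X_sub_C_scaleRoots {ι : Type*} (s : Finset ι) (a : ι → ℝ) (r : ℝ) :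
    (∏ i ∈ s, (X - C (a i))).scaleRoots r = ∏ i ∈ s, (X - C (a i * r)) := by
  classical
  induction s using Finset.induction_on with
  | empty => simp
  | insert i s hi ih =>
    rw [Finset.prod_insert hi, Finset.prod_insert hi, mul_scaleRoots_of_noZeroDivisors, ih,
      X_sub_C_scaleRoots]

theorem tendsto_coeff_prod_X_sub_C_mul {ι : Type*} (s : Finset ι) (a : ι → ℝ) {j : ℕ}
    (hj : j < s.card) :
    Tendsto (fun r : ℝ => (∏ i ∈ s, (X - C (a i * r))).coeff j) (𝓝 0) (𝓝 0) := by
  simp only [← prod_X_sub_C_scaleRoots, coeff_scaleRoots,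
    natDegree_finsetProd_X_sub_C_eq_card]
  refine Continuous.tendsto' (by fun_prop) _ _ ?_
  rw [zero_pow (by omega), mul_zero]

theorem tendsto_coeffPoint_prod_X_sub_C_mul {k : ℕ} {ι : Type*} (s : Finset ι) (a : ι → ℝ)
    (hs : k ≤ s.card) {f : ℝ → ℝ} (hf : Tendsto f (𝓝 0) (𝓝 0)) :
    Tendsto (fun r : ℝ => coeffPoint k (∏ i ∈ s, (X - C (a i * r))) (f r)) (𝓝 0) (𝓝 0) := by
  refine tendsto_pi_nhds.2 fun j => ?_
  by_cases hj : (j : ℕ) = 0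
  · simpa [coeffPoint, hj] using hf
  · simpa [coeffPoint, hj] using tendsto_coeff_prod_X_sub_C_mul s a (j.2.trans_le hs)

theorem exists_injective_sum_eq_zero (n : ℕ) :
    ∃ a : Fin n → ℝ, Function.Injective a ∧ ∑ i, a i = 0 := by
  refine ⟨fun i => i - ((n : ℝ) - 1) / 2, fun i j h => ?_, ?_⟩
  · simpa [Fin.ext_iff] using h
  · have h : (∑ i ∈ Finset.range n, (i : ℝ)) * 2 = n * (n - 1) := by
      induction n with
      | zero => simp
      | succ n ih => rw [Finset.sum_range_succ, add_mul, ih]; push_cast; ring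
    rw [Finset.sum_sub_distrib, Fin.sum_univ_eq_sum_range (fun i => (i : ℝ))]
    simp
    linarith

/-- For every pair of neighbourhoods `U, V` of the origin in `ℝ^k` there is a
point `s ∈ V` such that the equation `w_k t = s` has exactly `k+1` pairwise distinct solutions,
all lying in `U`, each of which is a regular point of `w_k` (its Fréchet derivative is a linear
isomorphism of `ℝ^k`). -/
theorem whitney_exact_solutions (k : ℕ) (hk : 0 < k) (U V : Set (Fin k → ℝ))
    (hU : U ∈ nhds (0 : Fin k → ℝ)) (hV : V ∈ nhds (0 : Fin k → ℝ)) :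
    ∃ s ∈ V, ∃ t : Fin (k + 1) → (Fin k → ℝ),
      Function.Injective t ∧
      (∀ i : Fin (k + 1), t i ∈ U ∧ whitney k hk (t i) = s ∧
        Function.Bijective (⇑(fderiv ℝ (whitney k hk) (t i)))) ∧
      (∀ u : Fin k → ℝ, whitney k hk u = s → ∃ i, u = t i) := by
  obtain ⟨a, ha, hsum⟩ := exists_injective_sum_eq_zero (k + 1)
  let Q (r : ℝ) : ℝ[X] := ∏ i, (X - C (a i * r))
  have hcard : (Finset.univ : Finset (Fin (k + 1))).card = k + 1 := by simp
  have hroots : ∀ᶠ r in 𝓝 (0 : ℝ), ∀ i, coeffPoint k (Q r) (a i * r) ∈ U :=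
    eventually_all.2 fun i => tendsto_coeffPoint_prod_X_sub_C_mul _ a (by omega)
      (Continuous.tendsto' (by fun_prop) _ _ (mul_zero _)) hU
  have hconst : Tendsto (fun r => -(Q r).coeff 0) (𝓝 0) (𝓝 0) := by
    have h := (tendsto_coeff_prod_X_sub_C_mul Finset.univ a (j := 0) (by omega)).neg
    rwa [neg_zero] at h
  have hvalue : ∀ᶠ r in 𝓝 (0 : ℝ), coeffPoint k (Q r) (-(Q r).coeff 0) ∈ V :=
    tendsto_coeffPoint_prod_X_sub_C_mul _ a (by omega) hconst hV
  have hexists : ∃ r : ℝ, r ≠ 0 ∧ (∀ i, coeffPoint k (Q r) (a i * r) ∈ U) ∧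
      coeffPoint k (Q r) (-(Q r).coeff 0) ∈ V :=
    (eventually_mem_nhdsWithin.and
      ((hroots.and hvalue).filter_mono nhdsWithin_le_nhds)).exists (f := 𝓝[≠] (0 : ℝ))
  obtain ⟨r, hr, hrU, hrV⟩ := hexists
  have hinj : Function.Injective fun i => a i * r := (mul_left_injective₀ hr).comp ha
  have hQ : (Q r).Monic := monic_prod_X_sub_C _ _
  have hdeg : (Q r).natDegree = k + 1 := by
    simp only [Q, natDegree_finsetProd_X_sub_C_eq_card, hcard]
  have hcoeff : (Q r).coeff k = 0 := by
    have h := prod_X_sub_C_coeff_card_pred Finset.univ (fun i => a i * r) (by omega)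
    rwa [hcard, Nat.add_sub_cancel, ← Finset.sum_mul, hsum, zero_mul, neg_zero] at h
  have heval (y : ℝ) : (Q r).eval y = 0 ↔ ∃ i, y = a i * r := by
    simp [Q, eval_prod, Finset.prod_eq_zero_iff, sub_eq_zero]
  have hsep : (Q r).Separable := separable_prod_X_sub_C_iff.2 hinj
  refine ⟨_, hrV, fun i => coeffPoint k (Q r) (a i * r),
    (coeffPoint_injective hk _).comp hinj, fun i => ⟨hrU i, ?_, ?_⟩, fun u hu => ?_⟩
  · rw [whitney_coeffPoint hk hQ hdeg hcoeff, (heval _).2 ⟨i, rfl⟩, zero_sub]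
  · exact bijective_fderiv_whitney_coeffPoint hk hQ hdeg hcoeff
      (hsep.eval₂_derivative_ne_zero (RingHom.id ℝ) ((heval _).2 ⟨i, rfl⟩))
  · have hu' := eq_coeffPoint_of_whitney_eq hk hu
    rw [hu', whitney_coeffPoint hk hQ hdeg hcoeff] at hu
    obtain ⟨i, hi⟩ := (heval (u ⟨0, hk⟩)).1 (by linarith [coeffPoint_injective hk _ hu])
    exact ⟨i, hu'.trans (congrArg _ hi)⟩
end

section
/- Let k ≥ 1 be an odd integer. There exist open neighbourhoods U_0, V_0 of the origin of ℝ^k with w_k(U_0) ⊆ V_0, and an open subset Ω_0 ⊆ V_0, such that: for every s ∈ Ω_0 the equation w_k(t) = s has no solution t ∈ U_0; and the origin belongs to the topological boundary of Ω_0 (in particular Ω_0 is non-empty). -/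
/-- On the slab `|x 0| < 1` the first coordinate of the Whitney map of odd index is bounded below
by minus the sum of the absolute values of the other coordinates. -/
lemma neg_sum_abs_le_whitney {k : ℕ} (hk : 0 < k) (hodd : Odd k) {x : Fin k → ℝ}
    (hx : |x ⟨0, hk⟩| < 1) :
    -∑ i : Fin k, (if (i : ℕ) = 0 then 0 else |whitney k hk x i|) ≤
      whitney k hk x ⟨0, hk⟩ := by
  have hpow : 0 ≤ x ⟨0, hk⟩ ^ (k + 1) := hodd.add_one.pow_nonneg _
  have hsum : -∑ i : Fin k, (if (i : ℕ) = 0 then 0 else |whitney k hk x i|) ≤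
      ∑ i : Fin k, (if (i : ℕ) = 0 then 0 else x i * x ⟨0, hk⟩ ^ (i : ℕ)) := by
    rw [← Finset.sum_neg_distrib]
    refine Finset.sum_le_sum fun i _ => ?_
    by_cases hi : (i : ℕ) = 0
    · simp [hi]
    · simp only [whitney, hi, if_false]
      refine (abs_le.mp ?_).1
      rw [abs_mul, abs_pow]
      exact mul_le_of_le_one_right (abs_nonneg _) (pow_le_one₀ (abs_nonneg _) hx.le)
  simpa only [whitney, if_true] using hsum.trans (le_add_of_nonneg_left hpow)


/-- Let `k ≥ 1` be odd.  There exist open neighbourhoods `U₀, V₀` of the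
origin of `ℝ^k` with `w_k(U₀) ⊆ V₀`, and an open subset `Ω₀ ⊆ V₀`, such that for every
`s ∈ Ω₀` the equation `w_k t = s` has no solution `t ∈ U₀`, and the origin belongs to the
topological boundary of `Ω₀` (in particular `Ω₀` is non-empty). -/
theorem whitney_no_solutions_region (k : ℕ) (hk : 0 < k) (hodd : Odd k) :
    ∃ U₀ V₀ : Set (Fin k → ℝ), IsOpen U₀ ∧ IsOpen V₀ ∧
      (0 : Fin k → ℝ) ∈ U₀ ∧ (0 : Fin k → ℝ) ∈ V₀ ∧
      whitney k hk '' U₀ ⊆ V₀ ∧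
      ∃ Ω₀ : Set (Fin k → ℝ), Ω₀ ⊆ V₀ ∧ IsOpen Ω₀ ∧
        (∀ s ∈ Ω₀, ∀ t ∈ U₀, whitney k hk t ≠ s) ∧
        (0 : Fin k → ℝ) ∈ frontier Ω₀ := by
  refine ⟨{x | |x ⟨0, hk⟩| < 1}, Set.univ, isOpen_lt (by fun_prop) continuous_const, isOpen_univ,
    by simp, Set.mem_univ _, Set.subset_univ _,
    {s | s ⟨0, hk⟩ < -∑ i : Fin k, (if (i : ℕ) = 0 then 0 else |s i|)}, Set.subset_univ _, ?_⟩
  have hopen : IsOpen {s : Fin k → ℝ |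
      s ⟨0, hk⟩ < -∑ i : Fin k, (if (i : ℕ) = 0 then 0 else |s i|)} := by
    refine isOpen_lt (by fun_prop) (Continuous.neg (continuous_finsetSum _ fun i _ => ?_))
    split_ifs <;> fun_prop
  refine ⟨hopen, ?_, ?_⟩
  · rintro s hs t ht rfl
    exact (neg_sum_abs_le_whitney hk hodd ht).not_gt hs
  · rw [hopen.frontier_eq]
    refine ⟨?_, by simp⟩
    have hcont : Continuous fun ε : ℝ => (Pi.single ⟨0, hk⟩ (-ε) : Fin k → ℝ) :=
      (continuous_single _).comp continuous_neg
    have hlim : Filter.Tendsto (fun ε : ℝ => (Pi.single ⟨0, hk⟩ (-ε) : Fin k → ℝ))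
        (nhdsWithin 0 (Set.Ioi 0)) (nhds 0) := by
      simpa using (hcont.tendsto 0).mono_left nhdsWithin_le_nhds
    refine mem_closure_of_tendsto hlim ?_
    filter_upwards [self_mem_nhdsWithin] with ε hε
    have hzero : ∑ i : Fin k, (if (i : ℕ) = 0 then 0 else
        |(Pi.single ⟨0, hk⟩ (-ε) : Fin k → ℝ) i|) = 0 := by
      refine Finset.sum_eq_zero fun i _ => ?_
      by_cases hi : (i : ℕ) = 0
      · simp [hi]
      · simp [hi, Fin.ext_iff]
    simpa [hzero] using hε
end

section
/- Let k ≥ 2 be an even integer and σ ∈ ℝ. The equation w_k(t) = (σ^{k+1}, 0, …, 0) has exactly one solution in ℝ^k, namely t = (σ, 0, …, 0); moreover, if σ ≠ 0 this solution is a regular point of w_k. -/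
/-- At a point of the first coordinate axis, the Whitney map has derivative
`v ↦ ((k + 1) σ ^ k v₀ + ∑ i > 0, σ ^ i vᵢ, v₁, …)`. -/
theorem hasFDerivAt_whitney_axis (k : ℕ) (hk : 0 < k) (σ : ℝ) :
    HasFDerivAt (whitney k hk)
      (ContinuousLinearMap.pi fun j : Fin k => if (j : ℕ) = 0 then
          ((k + 1 : ℕ) * σ ^ k) • ContinuousLinearMap.proj (R := ℝ) (φ := fun _ : Fin k => ℝ) ⟨0, hk⟩ +
            ∑ i : Fin k, (if (i : ℕ) = 0 then 0
              else σ ^ (i : ℕ) • ContinuousLinearMap.proj (R := ℝ) (φ := fun _ : Fin k => ℝ) i)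
        else ContinuousLinearMap.proj (R := ℝ) (φ := fun _ : Fin k => ℝ) j)
      (fun j : Fin k => if (j : ℕ) = 0 then σ else 0) := by
  have hproj (i : Fin k) (p : Fin k → ℝ) : HasFDerivAt (fun x : Fin k → ℝ => x i)
      (ContinuousLinearMap.proj (R := ℝ) (φ := fun _ : Fin k => ℝ) i) p :=
    hasFDerivAt_apply i p
  rw [hasFDerivAt_pi]
  intro j
  by_cases hj : (j : ℕ) = 0
  · simp only [whitney, hj, if_true]
    refine HasFDerivAt.add ?_ (HasFDerivAt.fun_sum fun i _ => ?_)
    · simpa using (hproj ⟨0, hk⟩ fun j : Fin k => if (j : ℕ) = 0 then σ else 0).pow (k + 1)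
    · by_cases hi : (i : ℕ) = 0
      · simpa only [hi, if_true] using hasFDerivAt_const (0 : ℝ) _
      · simp only [hi, if_false]
        simpa [hi] using (hproj i fun j : Fin k => if (j : ℕ) = 0 then σ else 0).fun_mul
          ((hproj ⟨0, hk⟩ fun j : Fin k => if (j : ℕ) = 0 then σ else 0).pow (i : ℕ))
  · simpa only [whitney, hj, if_false] using hproj j _

/-- A point whose image under the Whitney map lies on the first coordinate axis lies on that axis,
where the map is `σ ↦ σ ^ (k + 1)`. -/
theorem whitney_eq_axis_iff (k : ℕ) (hk : 0 < k) (a : ℝ) (t : Fin k → ℝ) :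
    whitney k hk t = (fun j : Fin k => if (j : ℕ) = 0 then a else 0) ↔
      t ⟨0, hk⟩ ^ (k + 1) = a ∧ ∀ j : Fin k, (j : ℕ) ≠ 0 → t j = 0 := by
  have hsum (ht : ∀ j : Fin k, (j : ℕ) ≠ 0 → t j = 0) :
      ∑ i : Fin k, (if (i : ℕ) = 0 then 0 else t i * t ⟨0, hk⟩ ^ (i : ℕ)) = 0 :=
    Finset.sum_eq_zero fun i _ => by
      by_cases hi : (i : ℕ) = 0 <;> simp [hi, ht]
  constructor
  · intro h
    have ht (j : Fin k) (hj : (j : ℕ) ≠ 0) : t j = 0 := by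
      simpa [whitney, hj] using congrFun h j
    exact ⟨by simpa [whitney, hsum ht] using congrFun h ⟨0, hk⟩, ht⟩
  · rintro ⟨h0, ht⟩
    funext j
    by_cases hj : (j : ℕ) = 0
    · simp [whitney, hj, hsum ht, h0]
    · simp [whitney, hj, ht j hj]

/-- Let `k ≥ 2` be even and `σ ∈ ℝ`.  The equation
`w_k t = (σ^(k+1), 0, …, 0)` has exactly one solution in `ℝ^k`, namely `t = (σ, 0, …, 0)`;
moreover, if `σ ≠ 0` this solution is a regular point of `w_k`. -/
theorem whitney_power_unique_solution (k : ℕ) (hk : 2 ≤ k) (heven : Even k) (σ : ℝ) :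
    (∀ t : Fin k → ℝ,
      whitney k (by omega) t = (fun j : Fin k => if (j : ℕ) = 0 then σ ^ (k + 1) else 0) ↔
        t = fun j : Fin k => if (j : ℕ) = 0 then σ else 0) ∧
    (σ ≠ 0 → Function.Bijective
      (⇑(fderiv ℝ (whitney k (by omega))
        (fun j : Fin k => if (j : ℕ) = 0 then σ else 0)))) := by
  have hk0 : 0 < k := by omega
  refine ⟨fun t => ?_, fun hσ => ?_⟩
  · rw [whitney_eq_axis_iff, heven.add_one.pow_inj]
    constructor
    · rintro ⟨h0, ht⟩
      funext j
      by_cases hj : (j : ℕ) = 0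
      · obtain rfl : j = ⟨0, hk0⟩ := Fin.ext hj
        simpa using h0
      · simp [hj, ht j hj]
    · rintro rfl
      exact ⟨by simp, fun j hj => by simp [hj]⟩
  · rw [(hasFDerivAt_whitney_axis k hk0 σ).fderiv]
    suffices hinj : Function.Injective _ from
      ⟨hinj, LinearMap.surjective_of_injective (f := ContinuousLinearMap.toLinearMap _) hinj⟩
    rw [injective_iff_map_eq_zero]
    intro v hv
    have hne (j : Fin k) (hj : (j : ℕ) ≠ 0) : v j = 0 := by
      simpa [hj] using congrFun hv j
    have hsum : ∑ i : Fin k, (if (i : ℕ) = 0 then (0 : (Fin k → ℝ) →L[ℝ] ℝ)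
        else σ ^ (i : ℕ) • ContinuousLinearMap.proj (R := ℝ) (φ := fun _ : Fin k => ℝ) i) v = 0 :=
      Finset.sum_eq_zero fun i _ => by
        by_cases hi : (i : ℕ) = 0 <;> simp [hi, hne]
    have hzero : ((k : ℝ) + 1) * σ ^ k * v ⟨0, hk0⟩ = 0 := by
      simpa only [ContinuousLinearMap.pi_apply, if_true, add_apply, smul_apply,
        ContinuousLinearMap.proj_apply, sum_apply, hsum, add_zero,
        smul_eq_mul, Pi.zero_apply, Nat.cast_add, Nat.cast_one] using congrFun hv ⟨0, hk0⟩
    have hcoef : ((k : ℝ) + 1) * σ ^ k ≠ 0 := by positivity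
    funext j
    by_cases hj : (j : ℕ) = 0
    · obtain rfl : j = ⟨0, hk0⟩ := Fin.ext hj
      exact (mul_eq_zero.mp hzero).resolve_left hcoef
    · exact hne j hj
end

section
/- Let k ≥ 1 be an integer and define F_0, F_{k+3} : ℝ^{k+1} → ℝ^{k+1} by F_0(t, t_1, …, t_k) = (t_k t^k + … + t_2 t^2 + t_1 t, t_1, …, t_k) and F_{k+3}(t, t_1, …, t_k) = (t^{k+3} + t_k t^k + … + t_2 t^2 + t_1 t, t_1, …, t_k). Then F_0 and F_{k+3} are not smoothly equivalent at the origin: there do not exist open neighbourhoods U, V of the origin of ℝ^{k+1} with F_0(U) ⊆ V, together with C^∞ diffeomorphisms α from U onto an open subset of ℝ^{k+1} and β from V onto an open subset of ℝ^{k+1} satisfying α(0) = 0, β(0) = 0 and β ∘ F_0 = F_{k+3} ∘ α on U. -/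
/-- The map `F₀ : ℝ^{k+1} → ℝ^{k+1}`,
`F₀(t, t_1, …, t_k) = (t_k t^k + … + t_2 t^2 + t_1 t, t_1, …, t_k)`. -/
noncomputable def Fzero (k : ℕ) (x : Fin (k + 1) → ℝ) : Fin (k + 1) → ℝ :=
  fun j => if (j : ℕ) = 0 then
      ∑ i : Fin (k + 1), (if (i : ℕ) = 0 then 0 else x i * (x 0) ^ (i : ℕ))
    else x j

/-- The map `F_{k+3} : ℝ^{k+1} → ℝ^{k+1}`,
`F_{k+3}(t, t_1, …, t_k) = (t^{k+3} + t_k t^k + … + t_2 t^2 + t_1 t, t_1, …, t_k)`. -/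
noncomputable def Fhigh (k : ℕ) (x : Fin (k + 1) → ℝ) : Fin (k + 1) → ℝ :=
  fun j => if (j : ℕ) = 0 then
      (x 0) ^ (k + 3) +
        ∑ i : Fin (k + 1), (if (i : ℕ) = 0 then 0 else x i * (x 0) ^ (i : ℕ))
    else x j

theorem Fzero_single_zero (k : ℕ) (t : ℝ) : Fzero k (Pi.single 0 t) = 0 := by
  have h : ∀ i : Fin (k + 1), (i : ℕ) ≠ 0 → (Pi.single 0 t : Fin (k + 1) → ℝ) i = 0 := fun i hi =>
    Pi.single_eq_of_ne (M := fun _ => ℝ) (fun h : i = 0 => hi (by rw [h]; rfl)) t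
  funext j
  simp only [Fzero, Pi.zero_apply]
  split_ifs with hj
  · refine Finset.sum_eq_zero fun i _ => ?_
    split_ifs with hi
    · rfl
    · rw [h i hi, zero_mul]
  · exact h j hj

theorem eq_zero_of_Fhigh_eq_zero {k : ℕ} {x : Fin (k + 1) → ℝ} (hx : Fhigh k x = 0) : x = 0 := by
  have h : ∀ i : Fin (k + 1), (i : ℕ) ≠ 0 → x i = 0 := fun i hi => by
    simpa only [Fhigh, if_neg hi, Pi.zero_apply] using congrFun hx i
  have hsum : ∑ i : Fin (k + 1), (if (i : ℕ) = 0 then 0 else x i * (x 0) ^ (i : ℕ)) = 0 := by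
    refine Finset.sum_eq_zero fun i _ => ?_
    split_ifs with hi
    · rfl
    · rw [h i hi, zero_mul]
  have h0 : x 0 ^ (k + 3) = 0 := by
    have h1 := congrFun hx 0
    simp only [Fhigh, hsum] at h1
    simpa using h1
  funext j
  by_cases hj : (j : ℕ) = 0
  · rw [show j = 0 from Fin.ext hj]
    exact eq_zero_of_pow_eq_zero h0
  · exact h j hj

/-- For `k ≥ 1`, the maps `F₀` and `F_{k+3}` are not smoothly equivalent at
the origin: there are no neighbourhoods `U, V` of the origin with `F₀(U) ⊆ V` and `C^∞`
diffeomorphisms `α` (from `U` onto an open set) and `β` (from `V` onto an open set) fixing the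
origin such that `β ∘ F₀ = F_{k+3} ∘ α` on `U`. -/
theorem Fzero_Fhigh_not_equivalent (k : ℕ) (hk : 1 ≤ k) :
    ¬ ∃ (U V : Set (Fin (k + 1) → ℝ))
        (α αi β βi : (Fin (k + 1) → ℝ) → (Fin (k + 1) → ℝ)),
      IsOpen U ∧ IsOpen V ∧
      (0 : Fin (k + 1) → ℝ) ∈ U ∧ (0 : Fin (k + 1) → ℝ) ∈ V ∧
      Set.MapsTo (Fzero k) U V ∧
      ContDiffOn ℝ (⊤ : ℕ∞) α U ∧ IsOpen (α '' U) ∧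
      ContDiffOn ℝ (⊤ : ℕ∞) αi (α '' U) ∧
      (∀ x ∈ U, αi (α x) = x) ∧ (∀ y ∈ α '' U, α (αi y) = y) ∧
      ContDiffOn ℝ (⊤ : ℕ∞) β V ∧ IsOpen (β '' V) ∧
      ContDiffOn ℝ (⊤ : ℕ∞) βi (β '' V) ∧
      (∀ x ∈ V, βi (β x) = x) ∧ (∀ y ∈ β '' V, β (βi y) = y) ∧
      α 0 = 0 ∧ β 0 = 0 ∧
      (∀ x ∈ U, β (Fzero k x) = Fhigh k (α x)) := by
  rintro ⟨U, V, α, αi, β, βi, hU, -, h0U, -, -, -, -, -, hαi, -, -, -, -, -, -, hα0, hβ0, hcomm⟩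
  have hcont : Continuous fun t : ℝ => (Pi.single 0 t : Fin (k + 1) → ℝ) :=
    continuous_single (A := fun _ : Fin (k + 1) => ℝ) 0
  have hnhds : ∀ᶠ t in nhdsWithin (0 : ℝ) {0}ᶜ, (Pi.single 0 t : Fin (k + 1) → ℝ) ∈ U :=
    nhdsWithin_le_nhds ((hU.preimage hcont).mem_nhds (by simpa using h0U))
  obtain ⟨t, htU, ht⟩ := (hnhds.and self_mem_nhdsWithin).exists
  have hαt : α (Pi.single 0 t) = 0 := eq_zero_of_Fhigh_eq_zero <| by
    rw [← hcomm _ htU, Fzero_single_zero, hβ0]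
  have hsingle : (Pi.single 0 t : Fin (k + 1) → ℝ) = 0 := by
    rw [← hαi _ htU, hαt]
    simpa only [hα0] using hαi 0 h0U
  exact ht (by simpa using hsingle)
end

section
/- Define ḡ : ℝ → ℝ by ḡ(t) = exp(−1/t²)·sin(1/t) for t ≠ 0 and ḡ(0) = 0, and define F̄ : (−1, 1) × ℓ²(ℕ) → ℝ × ℓ²(ℕ) by F̄(t, (t_1, t_2, …)) = (Σ_{h=1}^{∞} t_h t^h + ḡ(t), (t_1, t_2, …)). Then the solution set of the equation F̄(t, a) = (0, 0) is exactly {(0, 0)} ∪ {(1/(mπ), 0) : m ∈ ℤ \ {0}}. -/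
/-- `ḡ(t) = exp(−1/t²)·sin(1/t)` for `t ≠ 0`, `ḡ(0) = 0`. -/
noncomputable def gbar (t : ℝ) : ℝ :=
  if t = 0 then 0 else Real.exp (-(1 / t ^ 2)) * Real.sin (1 / t)

theorem gbar_eq_zero_iff (t : ℝ) :
    gbar t = 0 ↔ t = 0 ∨ ∃ m : ℤ, m ≠ 0 ∧ t = 1 / (m * Real.pi) := by
  by_cases h : t = 0
  · simp [gbar, h]
  · simp only [gbar, h, if_false, false_or, mul_eq_zero, Real.exp_ne_zero, Real.sin_eq_zero_iff]
    refine exists_congr fun m => ⟨fun hm => ⟨?_, ?_⟩, ?_⟩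
    · rintro rfl
      exact one_div_ne_zero h (by simpa using hm.symm)
    · rw [hm, one_div_one_div]
    · rintro ⟨-, hm⟩
      rw [hm, one_div_one_div]

/-- Define `F̄ : (−1,1) × ℓ²(ℕ) → ℝ × ℓ²(ℕ)` by
`F̄(t, (t_1, t_2, …)) = (∑_{h=1}^∞ t_h t^h + ḡ(t), (t_1, t_2, …))`.  The solution set of
`F̄(t, a) = (0, 0)` is exactly `{(0,0)} ∪ {(1/(mπ), 0) : m ∈ ℤ \ {0}}`. -/
theorem Fbar_solution_set (t : ℝ) (ht : |t| < 1) (a : lp (fun _ : ℕ => ℝ) 2) :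
    (((∑' n : ℕ, a n * t ^ (n + 1)) + gbar t = 0) ∧ a = 0) ↔
      ((t = 0 ∨ ∃ m : ℤ, m ≠ 0 ∧ t = 1 / (m * Real.pi)) ∧ a = 0) := by
  refine and_congr_left fun ha => ?_
  subst ha
  simpa using gbar_eq_zero_iff t
end

section
/- Define F̃ : (−1, 1) × ℓ²(ℕ) → ℝ × ℓ²(ℕ) by F̃(t, (t_1, t_2, t_3, …)) = (Σ_{h=1}^{∞} t_h t^h + g(t)·t, (t_1 + g(t), t_2, t_3, …)). Then the solution set of the equation F̃(t, a) = (0, 0) is exactly the curve {(t, (−g(t), 0, 0, …)) : t ∈ (−1, 1)}. -/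
/-- The flat function `g(t) = exp(−1/t²)` for `t ≠ 0`, `g(0) = 0`. -/
noncomputable def gflat (t : ℝ) : ℝ := if t = 0 then 0 else Real.exp (-(1 / t ^ 2))

/-- Define `F̃ : (−1,1) × ℓ²(ℕ) → ℝ × ℓ²(ℕ)` by
`F̃(t, (t_1, t_2, t_3, …)) = (∑_{h=1}^∞ t_h t^h + g(t)·t, (t_1 + g(t), t_2, t_3, …))`.
The solution set of `F̃(t, a) = (0, 0)` is exactly the curve
`{(t, (−g(t), 0, 0, …)) : t ∈ (−1, 1)}`.  Here the second component of `F̃` is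
`a + g(t)·e₀` with `e₀ = lp.single 2 0 1`, and `(−g(t), 0, 0, …) = lp.single 2 0 (−g(t))`. -/
theorem Ftilde_solution_set (t : ℝ) (ht : |t| < 1) (a : lp (fun _ : ℕ => ℝ) 2) :
    (((∑' n : ℕ, a n * t ^ (n + 1)) + gflat t * t = 0) ∧
      a + lp.single 2 0 (gflat t) = 0) ↔
      a = lp.single 2 0 (-(gflat t)) := by
  have h_neg : a + lp.single 2 0 (gflat t) = 0 ↔ a = lp.single 2 0 (-(gflat t)) := by
    rw [add_eq_zero_iff_eq_neg, lp.single_neg]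
  rw [h_neg, and_iff_right_iff_imp]
  rintro rfl
  rw [tsum_eq_single 0]
  · simp
  · intro n hn
    rw [lp.coeFn_single, Pi.single_eq_of_ne hn, zero_mul]
end

section
/- Let w : [0, π] → ℝ be continuous. There exists a twice continuously differentiable function v : [0, π] → ℝ with v'(0) = 0, v'(π) = 0 and v''(t) + v(t) = w(t) for all t ∈ [0, π] if and only if ∫_0^π w(t)·cos(t) dt = 0. -/
open Set Real intervalIntegral

/-- Variation of parameters: the solution of `v'' + v = g` with `v 0 = v' 0 = 0`, together with
its first derivative. -/
theorem hasDerivAt_variation_of_parameters {g : ℝ → ℝ} (hg : Continuous g) (t : ℝ) :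
    HasDerivAt (fun t => sin t * (∫ s in (0 : ℝ)..t, g s * cos s)
        - cos t * ∫ s in (0 : ℝ)..t, g s * sin s)
      (cos t * (∫ s in (0 : ℝ)..t, g s * cos s) + sin t * ∫ s in (0 : ℝ)..t, g s * sin s) t ∧
    HasDerivAt (fun t => cos t * (∫ s in (0 : ℝ)..t, g s * cos s)
        + sin t * ∫ s in (0 : ℝ)..t, g s * sin s)
      (g t - (sin t * (∫ s in (0 : ℝ)..t, g s * cos s)
        - cos t * ∫ s in (0 : ℝ)..t, g s * sin s)) t := by
  have hC : HasDerivAt (fun t => ∫ s in (0 : ℝ)..t, g s * cos s) (g t * cos t) t :=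
    ((hg.mul continuous_cos).integral_hasStrictDerivAt 0 t).hasDerivAt
  have hS : HasDerivAt (fun t => ∫ s in (0 : ℝ)..t, g s * sin s) (g t * sin t) t :=
    ((hg.mul continuous_sin).integral_hasStrictDerivAt 0 t).hasDerivAt
  constructor
  · refine (((hasDerivAt_sin t).mul hC).sub ((hasDerivAt_cos t).mul hS)).congr_deriv ?_
    ring
  · refine (((hasDerivAt_cos t).mul hC).add ((hasDerivAt_sin t).mul hS)).congr_deriv ?_
    linear_combination g t * sin_sq_add_cos_sq t

/-- A function with two successive derivatives, the second one continuous, is `C^2`. -/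
theorem contDiff_two_of_hasDerivAt {v v' v'' : ℝ → ℝ} (h₁ : ∀ t, HasDerivAt v (v' t) t)
    (h₂ : ∀ t, HasDerivAt v' (v'' t) t) (hc : Continuous v'') : ContDiff ℝ 2 v := by
  have e₁ : deriv v = v' := funext fun t => (h₁ t).deriv
  have e₂ : deriv v' = v'' := funext fun t => (h₂ t).deriv
  rw [show (2 : WithTop ℕ∞) = 1 + 1 from one_add_one_eq_two.symm, contDiff_succ_iff_deriv, e₁,
    contDiff_one_iff_deriv, e₂]
  exact ⟨fun t => (h₁ t).differentiableAt, by simp, fun t => (h₂ t).differentiableAt, hc⟩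


/-- Let `w : [0, π] → ℝ` be continuous.  There exists a twice continuously
differentiable function `v : [0, π] → ℝ` with `v'(0) = 0 = v'(π)` and `v'' + v = w` on
`[0, π]` if and only if `∫_0^π w(t)·cos(t) dt = 0`.  (Derivatives on `[0, π]` are taken
within the interval, so at the endpoints they are one-sided derivatives.) -/
theorem neumann_solvability_iff (w : ℝ → ℝ) (hw : ContinuousOn w (Set.Icc 0 Real.pi)) :
    (∃ v : ℝ → ℝ, ContDiffOn ℝ 2 v (Set.Icc 0 Real.pi) ∧
      derivWithin v (Set.Icc 0 Real.pi) 0 = 0 ∧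
      derivWithin v (Set.Icc 0 Real.pi) Real.pi = 0 ∧
      (∀ t ∈ Set.Icc 0 Real.pi,
        derivWithin (derivWithin v (Set.Icc 0 Real.pi)) (Set.Icc 0 Real.pi) t + v t = w t)) ↔
    ∫ t in (0 : ℝ)..Real.pi, w t * Real.cos t = 0 := by
  have hu : UniqueDiffOn ℝ (Icc 0 π) := uniqueDiffOn_Icc pi_pos
  have h0 : (0 : ℝ) ∈ Icc 0 π := left_mem_Icc.2 pi_pos.le
  have hπ : π ∈ Icc 0 π := right_mem_Icc.2 pi_pos.le
  constructor
  · rintro ⟨v, hv, hv0, hvπ, hode⟩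
    have hv' : ContDiffOn ℝ 1 (derivWithin v (Icc 0 π)) (Icc 0 π) :=
      hv.derivWithin hu (by norm_num)
    have key := integral_eq_sub_of_hasDerivAt_of_le pi_pos.le
      (f := fun t => derivWithin v (Icc 0 π) t * cos t + v t * sin t)
      (f' := fun t => w t * cos t)
      ((hv'.continuousOn.mul continuousOn_cos).add (hv.continuousOn.mul continuousOn_sin))
      (fun t ht => ?_)
      ((hw.mul continuousOn_cos).intervalIntegrable_of_Icc pi_pos.le)
    · simpa [hv0, hvπ] using key
    · have hmem := Icc_mem_nhds ht.1 ht.2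
      have ht' := Ioo_subset_Icc_self ht
      have d₁ := ((hv.differentiableOn (by norm_num) t ht').hasDerivWithinAt).hasDerivAt hmem
      have d₂ := ((hv'.differentiableOn (by norm_num) t ht').hasDerivWithinAt).hasDerivAt hmem
      refine ((d₂.mul (hasDerivAt_cos t)).add (d₁.mul (hasDerivAt_sin t))).congr_deriv ?_
      linear_combination cos t * hode t ht'
  · intro hint
    set g : ℝ → ℝ := IccExtend pi_pos.le ((Icc 0 π).domRestrict w) with hgdef
    have hg : Continuous g := (continuousOn_iff_continuous_domRestrict.1 hw).Icc_extend'
    have hgw : ∀ t ∈ Icc 0 π, g t = w t := fun t ht => by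
      rw [hgdef, IccExtend_of_mem _ _ ht, domRestrict_apply]
    set v : ℝ → ℝ := fun t => sin t * (∫ s in (0 : ℝ)..t, g s * cos s)
      - cos t * ∫ s in (0 : ℝ)..t, g s * sin s with hvdef
    set v' : ℝ → ℝ := fun t => cos t * (∫ s in (0 : ℝ)..t, g s * cos s)
      + sin t * ∫ s in (0 : ℝ)..t, g s * sin s with hv'def
    have h₁ : ∀ t, HasDerivAt v (v' t) t := fun t =>
      (hasDerivAt_variation_of_parameters hg t).1
    have h₂ : ∀ t, HasDerivAt v' (g t - v t) t := fun t =>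
      (hasDerivAt_variation_of_parameters hg t).2
    have hvc : Continuous v := continuous_iff_continuousAt.2 fun t => (h₁ t).continuousAt
    have hd : ∀ t ∈ Icc 0 π, derivWithin v (Icc 0 π) t = v' t := fun t ht =>
      (h₁ t).hasDerivWithinAt.derivWithin (hu t ht)
    have hgint : ∫ s in (0 : ℝ)..π, g s * cos s = 0 := by
      refine (integral_congr fun t ht => ?_).trans hint
      rw [uIcc_of_le pi_pos.le] at ht
      simp only [hgw t ht]
    refine ⟨v, (contDiff_two_of_hasDerivAt h₁ h₂ (hg.sub hvc)).contDiffOn, ?_, ?_, ?_⟩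
    · simp [hd 0 h0, hv'def]
    · simp [hd π hπ, hv'def, hgint]
    · intro t ht
      rw [derivWithin_congr hd (hd t ht), (h₂ t).hasDerivWithinAt.derivWithin (hu t ht), hgw t ht]
      ring
end
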